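/- arXiv:2107.10385 — 2 statements merged into one kernel-verified Lean document; each statement's English description precedes it below -/
import Mathlib

section
/- Consider the Boolean cube {0,1}ⁿ. For any E ⊊ {0,…,n}, HC_n(E) = PC_n(E) = min{d ∈ {0,…,n} : E is d-admitting}. -/
open MvPolynomial

noncomputable section

namespace CoveringSymmetric

/-- `N = ∑ᵢ (kᵢ - 1)` for the uniform grid `[0,k₁-1] × ⋯ × [0,kₙ-1]`. -/
def Ntot (n : ℕ) (k : Fin n → ℕ) : ℕ := ∑ i, (k i - 1)

/-- The integer points of the uniform grid `G = [0,k₁-1] × ⋯ × [0,kₙ-1]`. -/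
def gridSet (n : ℕ) (k : Fin n → ℕ) : Set (Fin n → ℕ) := {x | ∀ i, x i < k i}

/-- The real point of `ℝⁿ` corresponding to an integer point. -/
def toR {n : ℕ} (x : Fin n → ℕ) : Fin n → ℝ := fun i => (x i : ℝ)

/-- The weight `wt(x) = ∑ᵢ xᵢ` of a point. -/
def wt {n : ℕ} (x : Fin n → ℕ) : ℕ := ∑ i, x i

/-- The weight-determined set `E̲ = {x ∈ G : wt(x) ∈ E}`. -/
def wdSet (n : ℕ) (k : Fin n → ℕ) (E : Finset ℕ) : Set (Fin n → ℕ) :=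
  {x ∈ gridSet n k | wt x ∈ E}

/-- The layer `j̲ = {x ∈ G : wt(x) = j}`. -/
def layer (n : ℕ) (k : Fin n → ℕ) (j : ℕ) : Set (Fin n → ℕ) :=
  {x ∈ gridSet n k | wt x = j}

/-- The grid is strictly unimodal (SU²):
`|0̲| < ⋯ < |⌊N/2⌋̲| = |⌈N/2⌉̲| > ⋯ > |N̲|`. -/
def SU2 (n : ℕ) (k : Fin n → ℕ) : Prop :=
  (∀ j, j < Ntot n k / 2 → (layer n k j).ncard < (layer n k (j + 1)).ncard) ∧
  (layer n k (Ntot n k / 2)).ncard = (layer n k ((Ntot n k + 1) / 2)).ncard ∧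
  (∀ j, (Ntot n k + 1) / 2 ≤ j → j < Ntot n k →
    (layer n k (j + 1)).ncard < (layer n k j).ncard)

/-- The zero set `Z_G(P)` of a polynomial within the grid. -/
def ZG (n : ℕ) (k : Fin n → ℕ) (P : MvPolynomial (Fin n) ℝ) : Set (Fin n → ℕ) :=
  {x ∈ gridSet n k | eval (toR x) P = 0}

/-- The degree-`d` Zariski closure of `S ⊆ G` within the grid. -/
def Zcl (n : ℕ) (k : Fin n → ℕ) (d : ℕ) (S : Set (Fin n → ℕ)) : Set (Fin n → ℕ) :=
  {a ∈ gridSet n k | ∀ P : MvPolynomial (Fin n) ℝ, P.totalDegree ≤ d →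
    (∀ x ∈ S, eval (toR x) P = 0) → eval (toR a) P = 0}

/-- The degree-`d` Z*-closure of a weight-determined set, as a set of weights:
`{j ∈ [0,N] : j̲ ⊆ Z-cl_{G,d}(E̲)}`. -/
def Zstar (n : ℕ) (k : Fin n → ℕ) (d : ℕ) (E : Finset ℕ) : Set ℕ :=
  {j | j ≤ Ntot n k ∧ layer n k j ⊆ Zcl n k d (wdSet n k E)}

/-- `PC_G(E)`: minimum total degree of a nontrivial polynomial cover of `E̲`. -/
def PC (n : ℕ) (k : Fin n → ℕ) (E : Finset ℕ) : ℕ :=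
  sInf {d | ∃ P : MvPolynomial (Fin n) ℝ, P.totalDegree = d ∧
    wdSet n k E ⊆ ZG n k P ∧ ZG n k P ≠ gridSet n k}

/-- `PPC_G(E)`: minimum total degree of a proper polynomial cover of `E̲`. -/
def PPC (n : ℕ) (k : Fin n → ℕ) (E : Finset ℕ) : ℕ :=
  sInf {d | ∃ P : MvPolynomial (Fin n) ℝ, P.totalDegree = d ∧
    wdSet n k E ⊆ ZG n k P ∧
    ∀ j ≤ Ntot n k, j ∉ E → ¬ (layer n k j ⊆ ZG n k P)}

/-- `EPC_G(E)`: minimum total degree of an exact polynomial cover of `E̲`. -/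
def EPC (n : ℕ) (k : Fin n → ℕ) (E : Finset ℕ) : ℕ :=
  sInf {d | ∃ P : MvPolynomial (Fin n) ℝ, P.totalDegree = d ∧ ZG n k P = wdSet n k E}

/-- `x` lies on the affine hyperplane `{y ∈ ℝⁿ : ∑ᵢ wᵢ yᵢ = c}` (with `w ≠ 0`). -/
def onHyp {n : ℕ} (w : Fin n → ℝ) (c : ℝ) (x : Fin n → ℕ) : Prop :=
  ∑ i, w i * (x i : ℝ) = c

/-- `HC_G(E)`: minimum size of a nontrivial hyperplane cover of `E̲`. -/
def HC (n : ℕ) (k : Fin n → ℕ) (E : Finset ℕ) : ℕ :=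
  sInf {m | ∃ (w : Fin m → Fin n → ℝ) (c : Fin m → ℝ), (∀ t, w t ≠ 0) ∧
    (∀ x ∈ wdSet n k E, ∃ t, onHyp (w t) (c t) x) ∧
    ∃ x ∈ gridSet n k, ∀ t, ¬ onHyp (w t) (c t) x}

/-- `PHC_G(E)`: minimum size of a proper hyperplane cover of `E̲`. -/
def PHC (n : ℕ) (k : Fin n → ℕ) (E : Finset ℕ) : ℕ :=
  sInf {m | ∃ (w : Fin m → Fin n → ℝ) (c : Fin m → ℝ), (∀ t, w t ≠ 0) ∧
    (∀ x ∈ wdSet n k E, ∃ t, onHyp (w t) (c t) x) ∧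
    ∀ j ≤ Ntot n k, j ∉ E → ¬ (layer n k j ⊆ {x | ∃ t, onHyp (w t) (c t) x})}

/-- The certifying degree of `S ⊆ G`: least `d ∈ [0,N]` such that some polynomial of
total degree at most `d` is nonconstant on `G` but constant on `S`. -/
def certDeg (n : ℕ) (k : Fin n → ℕ) (S : Set (Fin n → ℕ)) : ℕ :=
  sInf {d | d ≤ Ntot n k ∧ ∃ f : MvPolynomial (Fin n) ℝ, f.totalDegree ≤ d ∧
    (∃ a ∈ gridSet n k, ∃ b ∈ gridSet n k, eval (toR a) f ≠ eval (toR b) f) ∧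
    ∀ a ∈ S, ∀ b ∈ S, eval (toR a) f = eval (toR b) f}

/-- `T_{N,i} = [0,i-1] ∪ [N-i+1,N]` (so `T_{N,0} = ∅`). -/
def T (N i : ℕ) : Finset ℕ := Finset.range i ∪ Finset.Icc (N - i + 1) N

/-- `E` is `(d,i)`-admitting: `E ∪ T_{N,i} ≠ [0,N]` and `|E \ T_{N,i}| ≤ d - i`. -/
def Admitting (N d i : ℕ) (E : Finset ℕ) : Prop :=
  E ∪ T N i ≠ Finset.range (N + 1) ∧ (E \ T N i).card ≤ d - i

/-- `E` is `d`-admitting: `(d,i)`-admitting for some `i ∈ [0,d]`. -/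
def DAdmitting (N d : ℕ) (E : Finset ℕ) : Prop :=
  ∃ i ≤ d, Admitting N d i E

/-- The operator `L_{N,d}`: if `E = {t₁ < ⋯ < t_s}` with `s ≥ d+1`, then
`L_{N,d}(E) = [0, t_{s-d}] ∪ E ∪ [t_{d+1}, N]`, and `L_{N,d}(E) = E` if `s ≤ d`.
(For `E ⊆ [0,N]`, `j ≤ t_{s-d}` iff `E` has at least `d+1` elements `≥ j`, and
`t_{d+1} ≤ j` iff `E` has at least `d+1` elements `≤ j`.) -/
def Lop (N d : ℕ) (E : Finset ℕ) : Finset ℕ :=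
  E ∪ (Finset.range (N + 1)).filter fun j =>
    d + 1 ≤ (E.filter fun t => j ≤ t).card ∨ d + 1 ≤ (E.filter fun t => t ≤ j).card

/-- `L̄_{N,d}(E) = ⋃ₘ L_{N,d}^m(E)`, the union of all iterates of `L_{N,d}` on `E`. -/
def Lbar (N d : ℕ) (E : Finset ℕ) : Set ℕ :=
  ⋃ m : ℕ, ((Lop N d)^[m] E : Set ℕ)

/-- `P` is a (possibly empty) product of polynomials of total degree at most 1. -/
def ProdLinear (n : ℕ) (P : MvPolynomial (Fin n) ℝ) : Prop :=
  ∃ (m : ℕ) (ℓ : Fin m → MvPolynomial (Fin n) ℝ),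
    (∀ t, (ℓ t).totalDegree ≤ 1) ∧ P = ∏ t, ℓ t

/-- The degree-`d` h-closure of `S ⊆ G`. -/
def hcl (n : ℕ) (k : Fin n → ℕ) (d : ℕ) (S : Set (Fin n → ℕ)) : Set (Fin n → ℕ) :=
  {a ∈ gridSet n k | ∀ P : MvPolynomial (Fin n) ℝ, ProdLinear n P → P.totalDegree ≤ d →
    (∀ x ∈ S, eval (toR x) P = 0) → eval (toR a) P = 0}

/-- The indicator point of a set of coordinates. -/
def ind {n : ℕ} (U : Finset (Fin n)) : Fin n → ℕ := fun i => if i ∈ U then 1 else 0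

lemma ind_mem_gridSet {n : ℕ} (U : Finset (Fin n)) : ind U ∈ gridSet n (fun _ => 2) := by
  intro i
  simp only [ind]
  split_ifs <;> norm_num

lemma wt_ind {n : ℕ} (U : Finset (Fin n)) : wt (ind U) = U.card := by
  simp [wt, ind]

lemma exists_eq_ind {n : ℕ} {x : Fin n → ℕ} (hx : x ∈ gridSet n (fun _ => 2)) :
    ∃ U, x = ind U := by
  refine ⟨Finset.univ.filter fun i => x i = 1, funext fun i => ?_⟩
  have : x i < 2 := hx i
  simp only [ind, Finset.mem_filter, Finset.mem_univ, true_and]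
  split_ifs <;> omega

lemma eval_ind {n : ℕ} (P : MvPolynomial (Fin n) ℝ) (U : Finset (Fin n)) :
    eval (toR (ind U)) P = ∑ m ∈ P.support, P.coeff m * if m.support ⊆ U then 1 else 0 := by
  rw [eval_eq]
  refine Finset.sum_congr rfl fun m _ => ?_
  congr 1
  have h : ∀ i ∈ m.support, (toR (ind U) i) ^ m i = if i ∈ U then 1 else 0 := by
    intro i hi
    have : m i ≠ 0 := by simpa using hi
    simp only [toR, ind]
    split_ifs <;> simp [this]
  rw [Finset.prod_congr rfl h, Finset.prod_boole]
  rfl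

lemma sum_powersetCard_subset {n : ℕ} {S A : Finset (Fin n)} (hS : S ⊆ A) (k : ℕ) :
    (∑ U ∈ A.powersetCard k, if S ⊆ U then (1 : ℝ) else 0) =
      A.card.choose k * (k.choose S.card / A.card.choose S.card) := by
  have hpos : (A.card.choose S.card : ℝ) ≠ 0 := by
    exact_mod_cast (Nat.choose_pos (Finset.card_le_card hS)).ne'
  rw [Finset.sum_boole]
  by_cases hk : S.card ≤ k
  · rw [Finset.card_filter_powersetCard_subset S A k hS hk, ← mul_div_assoc, eq_div_iff hpos]
    have := Nat.choose_mul (n := A.card) hk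
    rw [mul_comm]
    exact_mod_cast this.symm
  · rw [Nat.choose_eq_zero_of_lt (by omega : k < S.card), Finset.filter_eq_empty_iff.2]
    · simp
    · intro U hU hSU
      have := Finset.card_le_card hSU
      have := (Finset.mem_powersetCard.1 hU).2
      omega

/-- The sums of a polynomial over the layers below a set `A` are governed by a univariate
polynomial of no larger degree. -/
lemma exists_univariate {n : ℕ} (P : MvPolynomial (Fin n) ℝ) (A : Finset (Fin n)) :
    ∃ q : Polynomial ℝ, q.natDegree ≤ P.totalDegree ∧ ∀ k : ℕ,
      ∑ U ∈ A.powersetCard k, eval (toR (ind U)) P = A.card.choose k * q.eval (k : ℝ) := by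
  classical
  refine ⟨∑ m ∈ P.support with m.support ⊆ A,
    Polynomial.C (P.coeff m / (m.support.card.factorial * A.card.choose m.support.card)) *
      descPochhammer ℝ m.support.card, ?_, fun k => ?_⟩
  · refine Polynomial.natDegree_sum_le_of_forall_le _ _ fun m hm => ?_
    refine (Polynomial.natDegree_C_mul_le _ _).trans ?_
    rw [descPochhammer_natDegree]
    refine le_trans ?_ (le_totalDegree (Finset.mem_filter.1 hm).1)
    rw [Finset.card_eq_sum_ones]
    exact Finset.sum_le_sum fun i hi => Nat.one_le_iff_ne_zero.2 (by simpa using hi)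
  · simp_rw [eval_ind]
    rw [Finset.sum_comm, Polynomial.eval_finsetSum, Finset.mul_sum, Finset.sum_filter]
    refine Finset.sum_congr rfl fun m _ => ?_
    rw [← Finset.mul_sum]
    split_ifs with h
    · rw [sum_powersetCard_subset h, Polynomial.eval_mul, Polynomial.eval_C,
        descPochhammer_eval_eq_descFactorial, Nat.descFactorial_eq_factorial_mul_choose]
      have : (m.support.card.factorial : ℝ) ≠ 0 := by exact_mod_cast Nat.factorial_ne_zero _
      push_cast
      field_simp
    · rw [Finset.sum_eq_zero, mul_zero]
      intro U hU
      rw [if_neg fun hm => h (hm.trans (Finset.mem_powersetCard.1 hU).1)]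

lemma eval_eq_zero_of_layers_below {n : ℕ} {P : MvPolynomial (Fin n) ℝ} {A : Finset (Fin n)}
    {F : Finset ℕ} (hF : P.totalDegree < F.card)
    (h : ∀ U : Finset (Fin n), U.card ∈ F → eval (toR (ind U)) P = 0)
    (hA : ∀ k ∈ F, k ≤ A.card) : eval (toR (ind A)) P = 0 := by
  obtain ⟨q, hq, hsum⟩ := exists_univariate P A
  have hq0 : q = 0 := by
    refine Polynomial.eq_zero_of_natDegree_lt_card_of_eval_eq_zero q
      (f := fun k : F => ((k : ℕ) : ℝ)) (fun a b hab => ?_) (fun k => ?_) ?_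
    · exact Subtype.ext (Nat.cast_injective hab)
    · have h1 := hsum k
      rw [Finset.sum_eq_zero] at h1
      · have : ((A.card.choose k : ℕ) : ℝ) ≠ 0 := by
          exact_mod_cast (Nat.choose_pos (hA k k.2)).ne'
        exact (mul_eq_zero.1 h1.symm).resolve_left this
      · intro U hU
        exact h U (by rw [(Finset.mem_powersetCard.1 hU).2]; exact k.2)
    · rw [Fintype.card_coe]
      omega
  simpa [hq0] using hsum A.card

/-- The polynomial obtained by the substitution `Xᵢ ↦ 1 - Xᵢ`. -/
def reflect {n : ℕ} (P : MvPolynomial (Fin n) ℝ) : MvPolynomial (Fin n) ℝ :=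
  ∑ m ∈ P.support, C (P.coeff m) * ∏ i ∈ m.support, (1 - X i) ^ m i

lemma totalDegree_reflect_le {n : ℕ} (P : MvPolynomial (Fin n) ℝ) :
    (reflect P).totalDegree ≤ P.totalDegree := by
  refine totalDegree_finsetSum_le fun m hm => ?_
  refine (totalDegree_mul _ _).trans ?_
  rw [totalDegree_C, zero_add]
  refine (totalDegree_finsetProd _ _).trans (le_trans ?_ (le_totalDegree hm))
  refine Finset.sum_le_sum fun i _ => (totalDegree_pow _ _).trans ?_
  have : (1 - X i : MvPolynomial (Fin n) ℝ).totalDegree ≤ 1 :=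
    (totalDegree_sub _ _).trans (by simp)
  exact (Nat.mul_le_mul_left _ this).trans (mul_one _).le

lemma eval_reflect {n : ℕ} (P : MvPolynomial (Fin n) ℝ) (U : Finset (Fin n)) :
    eval (toR (ind U)) (reflect P) = eval (toR (ind Uᶜ)) P := by
  rw [reflect, eval_eq _ P, map_sum]
  refine Finset.sum_congr rfl fun m _ => ?_
  rw [map_mul, eval_C, map_prod]
  congr 1
  refine Finset.prod_congr rfl fun i _ => ?_
  by_cases hi : i ∈ U <;> simp [toR, ind, hi]

lemma eval_eq_zero_of_layers_above {n : ℕ} {P : MvPolynomial (Fin n) ℝ} {A : Finset (Fin n)}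
    {F : Finset ℕ} (hF : P.totalDegree < F.card)
    (h : ∀ U : Finset (Fin n), U.card ∈ F → eval (toR (ind U)) P = 0)
    (hA : ∀ k ∈ F, A.card ≤ k ∧ k ≤ n) : eval (toR (ind A)) P = 0 := by
  rw [← compl_compl A, ← eval_reflect]
  have hcard : ∀ U : Finset (Fin n), Uᶜ.card = n - U.card := fun U => by
    rw [Finset.card_compl, Fintype.card_fin]
  refine eval_eq_zero_of_layers_below (F := F.image fun k => n - k) ?_ (fun U hU => ?_) ?_
  · rw [Finset.card_image_of_injOn]
    · exact (totalDegree_reflect_le P).trans_lt hF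
    · intro a ha b hb hab
      have := hA a ha
      have := hA b hb
      simp only at hab
      omega
  · rw [eval_reflect]
    obtain ⟨k, hk, hkU⟩ := Finset.mem_image.1 hU
    refine h _ ?_
    have := hA k hk
    have hle : U.card ≤ n := by simpa using Finset.card_le_univ U
    rwa [hcard, ← hkU, Nat.sub_sub_self this.2]
  · intro k hk
    obtain ⟨l, hl, rfl⟩ := Finset.mem_image.1 hk
    have := hA l hl
    rw [hcard]
    omega

/-- If fewer than `d + 1` elements of `F` lie on each side of every missing weight, then `F`
is `d`-admitting. -/
lemma dAdmitting_of_closed {n d : ℕ} {F : Finset ℕ} (hF : F ⊆ Finset.range (n + 1))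
    (hne : ∃ j ≤ n, j ∉ F)
    (hlow : ∀ j ≤ n, j ∉ F → (F.filter (· ≤ j)).card ≤ d)
    (hup : ∀ j ≤ n, j ∉ F → (F.filter (j ≤ ·)).card ≤ d) : DAdmitting n d F := by
  classical
  have hex : ∃ i, i ≤ n ∧ (i ∉ F ∨ n - i ∉ F) := by
    obtain ⟨j, hj, hjF⟩ := hne
    exact ⟨j, hj, Or.inl hjF⟩
  obtain ⟨i, ⟨hi, hiF⟩, hmin'⟩ : ∃ i, (i ≤ n ∧ (i ∉ F ∨ n - i ∉ F)) ∧
      ∀ k < i, ¬ (k ≤ n ∧ (k ∉ F ∨ n - k ∉ F)) :=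
    ⟨Nat.find hex, Nat.find_spec hex, fun k hk => Nat.find_min hex hk⟩
  have hmin : ∀ k < i, k ∈ F ∧ n - k ∈ F := by
    intro k hk
    have := hmin' k hk
    by_contra hcon
    exact this ⟨by omega, by tauto⟩
  have h2i : i ≤ n - i := by
    by_contra hcon
    have := hmin (n - i) (by omega)
    rw [Nat.sub_sub_self hi] at this
    tauto
  have hTF : T n i ⊆ F := by
    intro k hk
    simp only [T, Finset.mem_union, Finset.mem_range, Finset.mem_Icc] at hk
    rcases hk with hk | hk
    · exact (hmin k hk).1
    · have := (hmin (n - k) (by omega)).2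
      rwa [Nat.sub_sub_self hk.2] at this
  have hcount : i + (F \ T n i).card ≤ d := by
    have hdisj : ∀ S : Finset ℕ, S ⊆ T n i → S.card = i →
        i + (F \ T n i).card = (S ∪ (F \ T n i)).card := by
      intro S hS hc
      rw [Finset.card_union_of_disjoint (Finset.disjoint_of_subset_left hS
        Finset.disjoint_sdiff), hc]
    rcases hiF with h | h
    · rw [hdisj (Finset.Icc (n - i + 1) n) Finset.subset_union_right (by simp; omega)]
      refine (Finset.card_le_card fun k hk => ?_).trans (hup i hi h)
      simp only [Finset.mem_union, Finset.mem_sdiff, Finset.mem_filter] at hk ⊢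
      rcases hk with hk | hk
      · refine ⟨hTF (Finset.subset_union_right hk), ?_⟩
        rw [Finset.mem_Icc] at hk
        omega
      · refine ⟨hk.1, ?_⟩
        by_contra hcon
        exact hk.2 (Finset.subset_union_left (Finset.mem_range.2 (by omega)))
    · rw [hdisj (Finset.range i) Finset.subset_union_left (by simp)]
      refine (Finset.card_le_card fun k hk => ?_).trans (hlow (n - i) (by omega) h)
      simp only [Finset.mem_union, Finset.mem_sdiff, Finset.mem_filter] at hk ⊢
      rcases hk with hk | hk
      · refine ⟨hTF (Finset.subset_union_left hk), ?_⟩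
        rw [Finset.mem_range] at hk
        omega
      · refine ⟨hk.1, ?_⟩
        by_contra hcon
        have := Finset.mem_range.1 (hF hk.1)
        exact hk.2 (Finset.subset_union_right (Finset.mem_Icc.2 (by omega)))
  refine ⟨i, by omega, ?_, by omega⟩
  rw [Finset.union_eq_left.2 hTF]
  rintro rfl
  obtain ⟨j, hj, hjF⟩ := hne
  exact hjF (Finset.mem_range.2 (by omega))

lemma DAdmitting.mono {n d : ℕ} {E F : Finset ℕ} (hF : F ⊆ Finset.range (n + 1)) (hEF : E ⊆ F)
    (h : DAdmitting n d F) : DAdmitting n d E := by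
  obtain ⟨i, hi, hne, hcard⟩ := h
  refine ⟨i, hi, fun hE => hne ?_, (Finset.card_le_card
    (Finset.sdiff_subset_sdiff hEF subset_rfl)).trans hcard⟩
  refine Finset.Subset.antisymm (Finset.union_subset hF ?_) ?_
  · exact hE ▸ Finset.subset_union_right
  · exact hE ▸ Finset.union_subset_union_left hEF

lemma dAdmitting_totalDegree {n : ℕ} {E : Finset ℕ} (hE : E ⊆ Finset.range (n + 1))
    {P : MvPolynomial (Fin n) ℝ} (hP : wdSet n (fun _ => 2) E ⊆ ZG n (fun _ => 2) P)
    (hP' : ZG n (fun _ => 2) P ≠ gridSet n (fun _ => 2)) : DAdmitting n P.totalDegree E := by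
  classical
  set F := (Finset.range (n + 1)).filter fun j =>
    ∀ U : Finset (Fin n), U.card = j → eval (toR (ind U)) P = 0 with hFdef
  have hFr : F ⊆ Finset.range (n + 1) := Finset.filter_subset _ _
  have hFP : ∀ U : Finset (Fin n), U.card ∈ F → eval (toR (ind U)) P = 0 :=
    fun U hU => (Finset.mem_filter.1 hU).2 U rfl
  have hwit : ∀ j ≤ n, j ∉ F → ∃ U : Finset (Fin n), U.card = j ∧ eval (toR (ind U)) P ≠ 0 := by
    intro j hj hjF
    by_contra! hcon
    exact hjF (Finset.mem_filter.2 ⟨Finset.mem_range.2 (by omega), hcon⟩)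
  have hEF : E ⊆ F := fun j hj => Finset.mem_filter.2 ⟨hE hj, fun U hU =>
    (hP (⟨ind_mem_gridSet U, by rwa [wt_ind, hU]⟩ : ind U ∈ wdSet n (fun _ => 2) E)).2⟩
  refine (dAdmitting_of_closed hFr ?_ (fun j hj hjF => ?_) fun j hj hjF => ?_).mono hFr hEF
  · by_contra! hcon
    refine hP' (Set.Subset.antisymm (fun x hx => hx.1) fun x hx => ⟨hx, ?_⟩)
    obtain ⟨U, rfl⟩ := exists_eq_ind hx
    exact hFP U (hcon _ (by simpa using Finset.card_le_univ U))
  · obtain ⟨U, rfl, hU⟩ := hwit j hj hjF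
    by_contra! hcon
    exact hU (eval_eq_zero_of_layers_below hcon
      (fun V hV => hFP V (Finset.mem_filter.1 hV).1) fun k hk => (Finset.mem_filter.1 hk).2)
  · obtain ⟨U, rfl, hU⟩ := hwit j hj hjF
    by_contra! hcon
    refine hU (eval_eq_zero_of_layers_above hcon
      (fun V hV => hFP V (Finset.mem_filter.1 hV).1) fun k hk => ?_)
    have := Finset.mem_range.1 (hFr (Finset.mem_filter.1 hk).1)
    exact ⟨(Finset.mem_filter.1 hk).2, by omega⟩

/-- The hyperplanes `∑ᵢ w t i * yᵢ = c t`, for `t : ι`, form a nontrivial cover of `E̲`. -/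
def IsHypCover {ι : Type} (n : ℕ) (E : Finset ℕ) (w : ι → Fin n → ℝ) (c : ι → ℝ) : Prop :=
  (∀ t, w t ≠ 0) ∧ (∀ x ∈ wdSet n (fun _ => 2) E, ∃ t, onHyp (w t) (c t) x) ∧
    ∃ x ∈ gridSet n (fun _ => 2), ∀ t, ¬ onHyp (w t) (c t) x

lemma IsHypCover.comp_equiv {ι κ : Type} {n : ℕ} {E : Finset ℕ} {w : ι → Fin n → ℝ} {c : ι → ℝ}
    (h : IsHypCover n E w c) (e : κ ≃ ι) : IsHypCover n E (w ∘ e) (c ∘ e) := by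
  obtain ⟨h1, h2, x, hx, h3⟩ := h
  refine ⟨fun t => h1 _, fun y hy => ?_, x, hx, fun t => h3 _⟩
  obtain ⟨t, ht⟩ := h2 y hy
  exact ⟨e.symm t, by simpa using ht⟩

lemma exists_polynomial_of_isHypCover {n m : ℕ} {E : Finset ℕ} {w : Fin m → Fin n → ℝ}
    {c : Fin m → ℝ} (h : IsHypCover n E w c) : ∃ P : MvPolynomial (Fin n) ℝ,
      P.totalDegree ≤ m ∧ wdSet n (fun _ => 2) E ⊆ ZG n (fun _ => 2) P ∧
      ZG n (fun _ => 2) P ≠ gridSet n (fun _ => 2) := by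
  obtain ⟨-, h2, x, hx, h3⟩ := h
  have heval : ∀ y : Fin n → ℕ, eval (toR y) (∏ t, (∑ i, C (w t i) * X i - C (c t))) = 0 ↔
      ∃ t, onHyp (w t) (c t) y := by
    intro y
    simp [map_prod, Finset.prod_eq_zero_iff, onHyp, toR, sub_eq_zero]
  refine ⟨∏ t, (∑ i, C (w t i) * X i - C (c t)), ?_, fun y hy => ⟨hy.1, ?_⟩, fun hZ => ?_⟩
  · refine (totalDegree_finsetProd _ _).trans ?_
    refine (Finset.sum_le_card_nsmul _ _ 1 fun t _ => ?_).trans (by simp)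
    refine (totalDegree_sub_C_le _ _).trans (totalDegree_finsetSum_le fun i _ => ?_)
    exact (totalDegree_mul _ _).trans (by simp)
  · exact (heval y).2 (h2 y hy)
  · rw [← hZ] at hx
    obtain ⟨t, ht⟩ := (heval x).1 hx.2
    exact h3 t ht

lemma wt_bounds_of_ne_rev {n i : ℕ} (hi : 2 * i ≤ n) {x : Fin n → ℕ}
    (hx : x ∈ gridSet n (fun _ => 2)) (h : ∀ t : Fin n, (t : ℕ) < i → x t ≠ x t.rev) :
    i ≤ wt x ∧ wt x ≤ n - i := by
  have hs : ∑ t : Fin n, (if (t : ℕ) < i then 1 else 0) = i := by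
    rw [Fin.sum_univ_eq_sum_range (fun t => if t < i then 1 else 0) n, Finset.sum_boole]
    have : (Finset.range n).filter (· < i) = Finset.range i := by
      ext k
      simp only [Finset.mem_filter, Finset.mem_range]
      omega
    simp [this]
  have hs' : ∑ t : Fin n, (if (t.rev : ℕ) < i then 1 else 0) = i :=
    (Equiv.sum_comp Fin.revPerm fun t : Fin n => if (t : ℕ) < i then 1 else 0).trans hs
  have hw : ∑ t : Fin n, x t.rev = wt x := Equiv.sum_comp Fin.revPerm x
  have hpt : ∀ t : Fin n, ((if (t : ℕ) < i then 1 else 0) + (if (t.rev : ℕ) < i then 1 else 0) ≤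
      x t + x t.rev) ∧ x t + x t.rev + ((if (t : ℕ) < i then 1 else 0) +
      (if (t.rev : ℕ) < i then 1 else 0)) ≤ 2 := by
    intro t
    have h1 := hx t
    have h2 := hx t.rev
    have h3 := h t
    have h4 := h t.rev
    rw [Fin.rev_rev] at h4
    have h5 := Fin.val_rev t
    have h6 := t.2
    simp only at h1 h2
    split_ifs <;> omega
  have hlow := Finset.sum_le_sum fun t (_ : t ∈ Finset.univ) => (hpt t).1
  have hup := Finset.sum_le_sum fun t (_ : t ∈ Finset.univ) => (hpt t).2
  simp only [Finset.sum_add_distrib, hs, hs', hw, Finset.sum_const, Finset.card_univ,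
    Fintype.card_fin, smul_eq_mul] at hlow hup
  change i + i ≤ wt x + wt x at hlow
  change wt x + wt x + _ ≤ _ at hup
  omega

lemma exists_isHypCover_of_admitting {n d i : ℕ} (hn : 1 ≤ n) {E : Finset ℕ}
    (hE : E ⊆ Finset.range (n + 1)) (hid : i ≤ d) (hin : i ≤ n) (h : Admitting n d i E) :
    ∃ m ≤ d, ∃ (w : Fin m → Fin n → ℝ) (c : Fin m → ℝ), IsHypCover n E w c := by
  classical
  obtain ⟨hne, hcard⟩ := h
  obtain ⟨j, hj, hjET⟩ : ∃ j ≤ n, j ∉ E ∪ T n i := by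
    by_contra! hcon
    refine hne (Finset.Subset.antisymm (Finset.union_subset hE fun k hk => ?_) fun k hk =>
      hcon k (by simpa [Nat.lt_succ_iff] using hk))
    simp only [T, Finset.mem_union, Finset.mem_range, Finset.mem_Icc] at hk ⊢
    omega
  simp only [T, Finset.mem_union, Finset.mem_range, Finset.mem_Icc, not_or] at hjET
  obtain ⟨hjE, hij, hjn⟩ := hjET
  have h2i : 2 * i ≤ n := by omega
  let w : Fin i ⊕ {k // k ∈ E \ T n i} → Fin n → ℝ := Sum.elim
    (fun t => Pi.single ⟨t, by omega⟩ 1 - Pi.single (Fin.rev ⟨t, by omega⟩) 1) fun _ _ => 1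
  let c : Fin i ⊕ {k // k ∈ E \ T n i} → ℝ := Sum.elim (fun _ => 0) fun k => (k : ℕ)
  have hpair : ∀ (t : Fin i) (x : Fin n → ℕ), onHyp (w (Sum.inl t)) (c (Sum.inl t)) x ↔
      x ⟨t, by omega⟩ = x (Fin.rev ⟨t, by omega⟩) := by
    intro t x
    simp [w, c, onHyp, sub_mul, Pi.single_apply, sub_eq_zero]
  have hlayer : ∀ (k : {k // k ∈ E \ T n i}) (x : Fin n → ℕ),
      onHyp (w (Sum.inr k)) (c (Sum.inr k)) x ↔ wt x = k := by
    intro k x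
    simp only [w, c, onHyp, wt, Sum.elim_inr, one_mul]
    exact_mod_cast Iff.rfl
  have hcover : IsHypCover n E w c := by
    refine ⟨?_, fun x hx => ?_, ind (Finset.univ.filter fun t : Fin n => (t : ℕ) < j),
      ind_mem_gridSet _, ?_⟩
    · rintro (t | k) h0
      · have := congrFun h0 ⟨t, by omega⟩
        have hne : (⟨t, by omega⟩ : Fin n) ≠ Fin.rev ⟨t, by omega⟩ := by
          rw [Ne, Fin.ext_iff, Fin.val_rev]
          simp only
          omega
        simp [w, hne] at this
      · simpa [w] using congrFun h0 ⟨0, hn⟩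
    · by_contra! hcon
      have hb := wt_bounds_of_ne_rev h2i hx.1 fun t ht heq =>
        hcon (Sum.inl ⟨t, ht⟩) ((hpair ⟨t, ht⟩ x).2 heq)
      refine hcon (Sum.inr ⟨wt x, Finset.mem_sdiff.2 ⟨hx.2, ?_⟩⟩) ((hlayer _ x).2 rfl)
      simp only [T, Finset.mem_union, Finset.mem_range, Finset.mem_Icc]
      omega
    · rintro (t | k)
      · rw [hpair]
        have := t.2
        simp only [ind, Finset.mem_filter, Finset.mem_univ, true_and, Fin.val_rev]
        rw [if_pos (by omega), if_neg (by omega)]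
        exact one_ne_zero
      · rw [hlayer, wt_ind]
        intro hk
        refine hjE ?_
        have hjc : (Finset.univ.filter fun t : Fin n => (t : ℕ) < j).card = j := by
          rw [Fin.card_filter_val_lt]
          omega
        rw [← hjc, hk]
        exact (Finset.mem_sdiff.1 k.2).1
  refine ⟨i + (E \ T n i).card, by omega, _, _,
    hcover.comp_equiv (Fintype.equivFinOfCardEq ?_).symm⟩
  simp

/-- `HC_n(E) = PC_n(E) = min{d ∈ [0,n] : E is d-admitting}`. -/
theorem stmt3 (n : ℕ) (hn : 1 ≤ n) (E : Finset ℕ) (hE : E ⊂ Finset.range (n + 1)) :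
    HC n (fun _ => 2) E = PC n (fun _ => 2) E ∧
    PC n (fun _ => 2) E = sInf {d | d ≤ n ∧ DAdmitting n d E} := by
  have hn_adm : n ∈ {d | d ≤ n ∧ DAdmitting n d E} := by
    refine ⟨le_rfl, 0, Nat.zero_le _, ?_, ?_⟩
    · simpa [T] using hE.ne
    · have := Finset.card_lt_card hE
      simp only [Finset.card_range] at this
      simpa [T] using Nat.lt_succ_iff.1 this
  obtain ⟨hdn, i, hi, hadm⟩ := Nat.sInf_mem ⟨n, hn_adm⟩
  obtain ⟨m, hm, w, c, hwc⟩ := exists_isHypCover_of_admitting hn hE.subset hi (hi.trans hdn) hadm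
  have hHC_le : HC n (fun _ => 2) E ≤ sInf {d | d ≤ n ∧ DAdmitting n d E} :=
    le_trans (Nat.sInf_le (by exact ⟨w, c, hwc⟩)) hm
  have hPC_le : PC n (fun _ => 2) E ≤ HC n (fun _ => 2) E := by
    obtain ⟨w', c', hwc'⟩ := Nat.sInf_mem (s := {m | ∃ (w : Fin m → Fin n → ℝ) (c : Fin m → ℝ),
      IsHypCover n E w c}) ⟨m, w, c, hwc⟩
    obtain ⟨P, hPd, hP⟩ := exists_polynomial_of_isHypCover hwc'
    exact le_trans (Nat.sInf_le (by exact ⟨P, rfl, hP⟩)) hPd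
  have hle_PC : sInf {d | d ≤ n ∧ DAdmitting n d E} ≤ PC n (fun _ => 2) E := by
    obtain ⟨P₀, -, hP₀⟩ := exists_polynomial_of_isHypCover hwc
    obtain ⟨P, hPd, hP, hP'⟩ := Nat.sInf_mem (s := {d | ∃ P : MvPolynomial (Fin n) ℝ,
      P.totalDegree = d ∧ wdSet n (fun _ => 2) E ⊆ ZG n (fun _ => 2) P ∧
      ZG n (fun _ => 2) P ≠ gridSet n (fun _ => 2)}) ⟨_, P₀, rfl, hP₀⟩
    change _ = PC n (fun _ => 2) E at hPd
    rw [← hPd]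
    by_cases hdn : P.totalDegree ≤ n
    · exact Nat.sInf_le ⟨hdn, dAdmitting_totalDegree hE.subset hP hP'⟩
    · exact (Nat.sInf_le hn_adm).trans (by omega)
  omega

end CoveringSymmetric
end
end

section
/- Consider the Boolean cube {0,1}ⁿ. For any E ⊊ {0,…,n}, PHC_n(E) = PPC_n(E) = |E| - max{i ∈ {0,…,⌊n/2⌋} : T_{n,i} ⊆ E}. -/
open MvPolynomial

noncomputable section

namespace CoveringSymmetric

lemma totalDegree_prod_X_sub_C_le {σ R : Type*} [CommRing R] [Nontrivial R] (b : σ → R) (s : Finset σ) :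
    (∏ i ∈ s, (X i - C (b i)) : MvPolynomial σ R).totalDegree ≤ s.card := by
  refine (totalDegree_finsetProd _ _).trans ?_
  rw [Finset.card_eq_sum_ones]
  refine Finset.sum_le_sum fun i _ => (totalDegree_sub_C_le _ _).trans ?_
  exact (totalDegree_X i).le

lemma coeff_indicator_prod_X_sub_C {σ R : Type*} [CommRing R] [Nontrivial R] (b : σ → R) (s : Finset σ) :
    (∏ i ∈ s, (X i - C (b i)) : MvPolynomial σ R).coeff
      (∑ i ∈ s, Finsupp.single i 1) = 1 := by
  classical
  induction s using Finset.induction_on with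
  | empty => simp
  | insert i s hi ih =>
    have hlt : (∏ i ∈ s, (X i - C (b i)) : MvPolynomial σ R).totalDegree <
        (Finsupp.single i 1 + ∑ i ∈ s, Finsupp.single i 1 : σ →₀ ℕ).degree := by
      refine (totalDegree_prod_X_sub_C_le b s).trans_lt ?_
      simp
    rw [Finset.prod_insert hi, Finset.sum_insert hi, sub_mul, coeff_sub, coeff_C_mul,
      coeff_eq_zero_of_totalDegree_lt hlt, coeff_X_mul, ih, mul_zero, sub_zero]

/-- A polynomial that is nonzero at exactly one vertex of a subcube has total degree at least
the dimension of the subcube. -/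
lemma card_le_totalDegree_of_eval_ne_zero {σ : Type*} [Finite σ] (R : MvPolynomial σ ℝ)
    (a : σ → ℝ) (s : Finset σ) (ha : ∀ i, a i = 0 ∨ a i = 1) (h0 : eval a R ≠ 0)
    (h : ∀ y : σ → ℝ, (∀ i, y i = 0 ∨ y i = 1) → (∀ i ∉ s, y i = a i) → y ≠ a →
      eval y R = 0) : s.card ≤ R.totalDegree := by
  classical
  by_contra! hlt
  set Q : MvPolynomial σ ℝ := ∏ i ∈ s, (X i - C (1 - a i)) with hQ
  set t : σ →₀ ℕ := ∑ i ∈ s, Finsupp.single i 1 with ht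
  have htdeg : t.degree = s.card := by simp [ht]
  have htap : ∀ i, t i = if i ∈ s then 1 else 0 := by
    intro i
    simp [ht, Finsupp.finsetSum_apply, Finsupp.single_apply]
  have hQa : eval a Q ≠ 0 := by
    rw [hQ, eval_prod, Finset.prod_ne_zero_iff]
    intro i _
    rcases ha i with h | h <;> simp [h]
  set c := eval a R / eval a Q with hc
  have hc0 : c ≠ 0 := div_ne_zero h0 hQa
  have hRt : R.coeff t = 0 := coeff_eq_zero_of_totalDegree_lt (hlt.trans_eq htdeg.symm)
  have hcoeff : (R - C c * Q).coeff t ≠ 0 := by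
    rw [coeff_sub, coeff_C_mul, hRt, hQ, ht, coeff_indicator_prod_X_sub_C]
    simpa using hc0
  have hdeg : (R - C c * Q).totalDegree = t.degree := by
    apply le_antisymm
    · rw [htdeg]
      refine (totalDegree_sub _ _).trans (max_le hlt.le ?_)
      refine (totalDegree_mul _ _).trans ?_
      rw [totalDegree_C, zero_add]
      exact totalDegree_prod_X_sub_C_le _ _
    · exact le_totalDegree (mem_support_iff.mpr hcoeff)
  obtain ⟨y, hy, hne⟩ := combinatorial_nullstellensatz_exists_eval_nonzero (R - C c * Q) t hcoeff
    hdeg (fun i => if i ∈ s then {0, 1} else {a i}) (by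
      intro i
      rw [htap]
      split_ifs <;> simp)
  apply hne
  have hy' : ∀ i ∉ s, y i = a i := fun i hi => by simpa [hi] using hy i
  have hy01 : ∀ i, y i = 0 ∨ y i = 1 := fun i => by
    by_cases hi : i ∈ s
    · simpa [hi] using hy i
    · rw [hy' i hi]; exact ha i
  by_cases hya : y = a
  · subst hya
    simp [hc, div_mul_cancel₀ _ hQa]
  · obtain ⟨i, hi⟩ := Function.ne_iff.mp hya
    have his : i ∈ s := by
      by_contra h
      exact hi (hy' i h)
    have hQy : eval y Q = 0 := by
      rw [hQ, eval_prod]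
      refine Finset.prod_eq_zero his ?_
      rcases ha i with h1 | h1 <;> rcases hy01 i with h2 | h2 <;> simp_all
    simp [h y hy01 hy' hya, hQy]

lemma eval_sum_X_toR {n : ℕ} (x : Fin n → ℕ) :
    eval (toR x) (∑ i, X i : MvPolynomial (Fin n) ℝ) = (wt x : ℝ) := by
  simp [toR, wt]

/-- If every point other than `a` of the subcube through `a` with directions `s` has its weight in
a set `W` of size `|s|` not containing `wt a`, a polynomial vanishing on `E` but not at `a` has degree at least
`|E ∩ W|`. -/
lemma card_inter_le_totalDegree {n : ℕ} (P : MvPolynomial (Fin n) ℝ) (E W : Finset ℕ)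
    (hP : wdSet n (fun _ => 2) E ⊆ ZG n (fun _ => 2) P) (a : Fin n → ℕ)
    (ha : a ∈ gridSet n (fun _ => 2)) (h0 : eval (toR a) P ≠ 0) (s : Finset (Fin n))
    (hs : W.card = s.card) (haW : wt a ∉ W)
    (hW : ∀ y ∈ gridSet n (fun _ => 2), (∀ i ∉ s, y i = a i) → y ≠ a → wt y ∈ W) :
    (E ∩ W).card ≤ P.totalDegree := by
  set Q : MvPolynomial (Fin n) ℝ := ∏ j ∈ W \ E, (∑ i, X i - C (j : ℝ)) with hQ
  have hQdeg : Q.totalDegree ≤ (W \ E).card := by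
    refine (totalDegree_finsetProd _ _).trans ?_
    rw [Finset.card_eq_sum_ones]
    refine Finset.sum_le_sum fun j _ => (totalDegree_sub_C_le _ _).trans ?_
    exact totalDegree_finsetSum_le fun i _ => (totalDegree_X i).le
  have key : s.card ≤ (P * Q).totalDegree := by
    refine card_le_totalDegree_of_eval_ne_zero (P * Q) (toR a) s ?_ ?_ ?_
    · intro i
      have : a i < 2 := ha i
      interval_cases h : a i <;> simp [toR, h]
    · rw [eval_mul]
      refine mul_ne_zero h0 ?_
      rw [hQ, eval_prod, Finset.prod_ne_zero_iff]
      intro j hj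
      rw [eval_sub, eval_sum_X_toR, eval_C, sub_ne_zero, ne_eq, Nat.cast_inj]
      intro h
      exact haW (h ▸ (Finset.mem_sdiff.mp hj).1)
    · intro y hy hys hya
      obtain ⟨x, hx, rfl⟩ : ∃ x ∈ gridSet n (fun _ => 2), toR x = y := by
        refine ⟨fun i => if y i = 0 then 0 else 1, ?_, ?_⟩
        · intro i
          dsimp only
          split_ifs <;> simp
        · funext i
          rcases hy i with h | h <;> simp [toR, h]
      have hxW : wt x ∈ W := hW x hx (fun i hi => Nat.cast_injective (hys i hi))
        (fun h => hya (h ▸ rfl))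
      rw [eval_mul]
      by_cases hxE : wt x ∈ E
      · rw [(hP ⟨hx, hxE⟩).2, zero_mul]
      · rw [hQ, eval_prod, Finset.prod_eq_zero (Finset.mem_sdiff.mpr ⟨hxW, hxE⟩), mul_zero]
        rw [eval_sub, eval_sum_X_toR, eval_C, sub_self]
  have h1 := key.trans (totalDegree_mul _ _)
  have h2 := Finset.card_sdiff_add_card_inter W E
  rw [Finset.inter_comm] at h2
  omega

lemma Ntot_two (n : ℕ) : Ntot n (fun _ => 2) = n := by simp [Ntot]

lemma wt_eq_card {n : ℕ} {a : Fin n → ℕ} (ha : a ∈ gridSet n (fun _ => 2)) :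
    wt a = (Finset.univ.filter fun i => a i = 1).card := by
  rw [wt, Finset.card_filter]
  refine Finset.sum_congr rfl fun i _ => ?_
  have : a i < 2 := ha i
  interval_cases a i <;> rfl

lemma wt_add_card_zero {n : ℕ} {a : Fin n → ℕ} (ha : a ∈ gridSet n (fun _ => 2)) :
    wt a + (Finset.univ.filter fun i => a i = 0).card = n := by
  rw [wt, Finset.card_filter, ← Finset.sum_add_distrib]
  trans ∑ i : Fin n, 1
  · refine Finset.sum_congr rfl fun i _ => ?_
    have : a i < 2 := ha i
    interval_cases a i <;> rfl
  · simp

lemma wt_le {n : ℕ} {a : Fin n → ℕ} (ha : a ∈ gridSet n (fun _ => 2)) : wt a ≤ n :=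
  (wt_add_card_zero ha).le.trans' (Nat.le_add_right _ _)

lemma wt_lt_wt {n : ℕ} {a b : Fin n → ℕ} (h : a ≤ b) (hne : a ≠ b) : wt a < wt b := by
  obtain ⟨-, i, hi⟩ := Pi.lt_def.mp (lt_of_le_of_ne h hne)
  exact Finset.sum_lt_sum (fun j _ => h j) ⟨i, Finset.mem_univ i, hi⟩

lemma card_inter_Ioc_le_totalDegree {n : ℕ} (P : MvPolynomial (Fin n) ℝ) (E : Finset ℕ)
    (hP : wdSet n (fun _ => 2) E ⊆ ZG n (fun _ => 2) P) (a : Fin n → ℕ)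
    (ha : a ∈ gridSet n (fun _ => 2)) (h0 : eval (toR a) P ≠ 0) :
    (E ∩ Finset.Ioc (wt a) n).card ≤ P.totalDegree := by
  refine card_inter_le_totalDegree P E _ hP a ha h0 (Finset.univ.filter fun i => a i = 0) ?_ ?_ ?_
  · have := wt_add_card_zero ha
    rw [Nat.card_Ioc]
    omega
  · simp
  · intro y hy hya hne
    refine Finset.mem_Ioc.mpr ⟨wt_lt_wt (fun i => ?_) hne.symm, wt_le hy⟩
    by_cases hi : a i = 0
    · simp [hi]
    · exact (hya i (by simpa using hi)).ge

lemma card_inter_range_le_totalDegree {n : ℕ} (P : MvPolynomial (Fin n) ℝ) (E : Finset ℕ)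
    (hP : wdSet n (fun _ => 2) E ⊆ ZG n (fun _ => 2) P) (a : Fin n → ℕ)
    (ha : a ∈ gridSet n (fun _ => 2)) (h0 : eval (toR a) P ≠ 0) :
    (E ∩ Finset.range (wt a)).card ≤ P.totalDegree := by
  refine card_inter_le_totalDegree P E _ hP a ha h0 (Finset.univ.filter fun i => a i = 1) ?_ ?_ ?_
  · rw [Finset.card_range, wt_eq_card ha]
  · simp
  · intro y hy hya hne
    refine Finset.mem_range.mpr (wt_lt_wt (fun i => ?_) hne)
    by_cases hi : a i = 1
    · exact (Nat.le_of_lt_succ (hy i)).trans_eq hi.symm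
    · exact (hya i (by simpa using hi)).le

/-- If `E` misses one of the layers `i`, `n - i`, every proper polynomial cover of `E̲` has degree
at least `|E| - i`. -/
lemma card_sub_le_totalDegree {n i : ℕ} (hi : i ≤ n) (P : MvPolynomial (Fin n) ℝ) (E : Finset ℕ)
    (hE : E ⊆ Finset.range (n + 1)) (hiE : i ∉ E ∨ n - i ∉ E)
    (hP : wdSet n (fun _ => 2) E ⊆ ZG n (fun _ => 2) P)
    (hprop : ∀ j ≤ Ntot n (fun _ => 2), j ∉ E →
      ¬ (layer n (fun _ => 2) j ⊆ ZG n (fun _ => 2) P)) :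
    E.card - i ≤ P.totalDegree := by
  rw [Ntot_two] at hprop
  rcases hiE with h | h
  · obtain ⟨a, ⟨ha, rfl⟩, haP⟩ := Set.not_subset.mp (hprop _ hi h)
    have hle := card_inter_Ioc_le_totalDegree P E hP a ha fun h => haP ⟨ha, h⟩
    have hsub : E ⊆ Finset.range (wt a) ∪ (E ∩ Finset.Ioc (wt a) n) := by
      intro j hj
      have h1 := Finset.mem_range.mp (hE hj)
      have h2 : j ≠ wt a := fun h' => h (h' ▸ hj)
      simp only [Finset.mem_union, Finset.mem_range, Finset.mem_inter, Finset.mem_Ioc, hj,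
        true_and]
      omega
    have h3 := (Finset.card_le_card hsub).trans (Finset.card_union_le _ _)
    rw [Finset.card_range] at h3
    omega
  · obtain ⟨a, ⟨ha, hwt⟩, haP⟩ := Set.not_subset.mp (hprop _ (Nat.sub_le n i) h)
    have hle := card_inter_range_le_totalDegree P E hP a ha fun h => haP ⟨ha, h⟩
    have hsub : E ⊆ (E ∩ Finset.range (wt a)) ∪ Finset.Ioc (wt a) n := by
      intro j hj
      have h1 := Finset.mem_range.mp (hE hj)
      have h2 : j ≠ wt a := fun h' => h (hwt ▸ h' ▸ hj)
      simp only [Finset.mem_union, Finset.mem_range, Finset.mem_inter, Finset.mem_Ioc, hj,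
        true_and]
      omega
    have h3 := (Finset.card_le_card hsub).trans (Finset.card_union_le _ _)
    rw [Nat.card_Ioc] at h3
    omega

/-- The product of the linear forms of a proper hyperplane cover is a proper polynomial cover. -/
lemma exists_polynomial_of_hyperplanes {n m : ℕ} (k : Fin n → ℕ) (E : Finset ℕ)
    (w : Fin m → Fin n → ℝ) (c : Fin m → ℝ)
    (hcov : ∀ x ∈ wdSet n k E, ∃ t, onHyp (w t) (c t) x)
    (hprop : ∀ j ≤ Ntot n k, j ∉ E → ¬ (layer n k j ⊆ {x | ∃ t, onHyp (w t) (c t) x})) :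
    ∃ P : MvPolynomial (Fin n) ℝ, P.totalDegree ≤ m ∧ wdSet n k E ⊆ ZG n k P ∧
      ∀ j ≤ Ntot n k, j ∉ E → ¬ (layer n k j ⊆ ZG n k P) := by
  have heval : ∀ x, eval (toR x) (∏ t, (∑ i, C (w t i) * X i - C (c t)) :
      MvPolynomial (Fin n) ℝ) = 0 ↔ ∃ t, onHyp (w t) (c t) x := by
    intro x
    simp [Finset.prod_eq_zero_iff, sub_eq_zero, onHyp, toR]
  refine ⟨∏ t, (∑ i, C (w t i) * X i - C (c t)), ?_, ?_, ?_⟩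
  · refine (totalDegree_finsetProd _ _).trans ?_
    trans ∑ t : Fin m, 1
    · refine Finset.sum_le_sum fun t _ => (totalDegree_sub_C_le _ _).trans ?_
      refine totalDegree_finsetSum_le fun i _ => (totalDegree_mul _ _).trans ?_
      simp
    · simp
  · exact fun x hx => ⟨hx.1, (heval x).mpr (hcov x hx)⟩
  · exact fun j hj hjE hsub => hprop j hj hjE fun x hx => (heval x).mp (hsub hx).2

lemma sum_add_sum_rev_le {n i : ℕ} (hi : 2 * i ≤ n) (f : Fin n → ℕ) :
    ∑ t : Fin i, (f ⟨t, by omega⟩ + f ⟨n - 1 - t, by omega⟩) ≤ ∑ p, f p := by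
  let g : Fin i ⊕ Fin i → Fin n :=
    Sum.elim (fun t => ⟨t, by omega⟩) (fun t => ⟨n - 1 - t, by omega⟩)
  have hg : Function.Injective g := by
    rintro (s | s) (t | t) h <;> simp [g, Fin.ext_iff] at h ⊢ <;> omega
  calc ∑ t : Fin i, (f ⟨t, by omega⟩ + f ⟨n - 1 - t, by omega⟩) = ∑ z, f (g z) := by
        rw [Fintype.sum_sum_type, ← Finset.sum_add_distrib]
        rfl
    _ = ∑ p ∈ Finset.univ.map ⟨g, hg⟩, f p := by simp
    _ ≤ ∑ p, f p := Finset.sum_le_sum_of_subset (Finset.subset_univ _)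

lemma exists_eq_rev_of_wt_mem_T {n i : ℕ} (hi : 2 * i ≤ n) {x : Fin n → ℕ}
    (hx : x ∈ gridSet n (fun _ => 2)) (hT : wt x ∈ T n i) :
    ∃ t : Fin i, x ⟨t, by omega⟩ = x ⟨n - 1 - t, by omega⟩ := by
  by_contra! hne
  have hx2 : ∀ p, x p < 2 := hx
  have h1 := sum_add_sum_rev_le hi x
  have h2 := sum_add_sum_rev_le hi fun p => 1 - x p
  have h3 : wt x + ∑ p, (1 - x p) = n := by
    rw [wt, ← Finset.sum_add_distrib]
    trans ∑ p : Fin n, 1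
    · refine Finset.sum_congr rfl fun p _ => ?_
      have := hx2 p
      omega
    · simp
  have h4 : ∑ t : Fin i, (x ⟨t, by omega⟩ + x ⟨n - 1 - t, by omega⟩) = i := by
    trans ∑ t : Fin i, 1
    · refine Finset.sum_congr rfl fun t _ => ?_
      have := hne t
      have := hx2 ⟨t, by omega⟩
      have := hx2 ⟨n - 1 - t, by omega⟩
      omega
    · simp
  have h5 : ∑ t : Fin i, ((1 - x ⟨t, by omega⟩) + (1 - x ⟨n - 1 - t, by omega⟩)) = i := by
    trans ∑ t : Fin i, 1
    · refine Finset.sum_congr rfl fun t _ => ?_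
      have := hne t
      have := hx2 ⟨t, by omega⟩
      have := hx2 ⟨n - 1 - t, by omega⟩
      omega
    · simp
  rw [h4] at h1
  rw [h5] at h2
  change i ≤ wt x at h1
  simp only [T, Finset.mem_union, Finset.mem_range, Finset.mem_Icc] at hT
  omega

lemma card_T {n i : ℕ} (hi : 2 * i ≤ n) : (T n i).card = 2 * i := by
  rw [T, Finset.card_union_of_disjoint, Finset.card_range, Nat.card_Icc]
  · omega
  · rw [Finset.disjoint_left]
    intro j
    simp only [Finset.mem_range, Finset.mem_Icc]
    omega

/-- A proper hyperplane cover of `E̲` by the `i` hyperplanes `x_t = x_{n-1-t}` and one hyperplane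
`∑ x_p = j` for each `j ∈ E \ T_{n,i}`. -/
lemma exists_hyperplanes {n i : ℕ} (hn : 1 ≤ n) (hi : 2 * i ≤ n) (E : Finset ℕ)
    (hT : T n i ⊆ E) :
    ∃ (w : Fin (E.card - i) → Fin n → ℝ) (c : Fin (E.card - i) → ℝ), (∀ t, w t ≠ 0) ∧
      (∀ x ∈ wdSet n (fun _ => 2) E, ∃ t, onHyp (w t) (c t) x) ∧
      ∀ j ≤ Ntot n (fun _ => 2), j ∉ E →
        ¬ (layer n (fun _ => 2) j ⊆ {x | ∃ t, onHyp (w t) (c t) x}) := by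
  have hcard : Fintype.card (Fin i ⊕ (E \ T n i : Finset ℕ)) = E.card - i := by
    have h1 := Finset.card_sdiff_add_card_eq_card hT
    rw [card_T hi] at h1
    rw [Fintype.card_sum, Fintype.card_fin, Fintype.card_coe]
    omega
  let e : Fin (E.card - i) ≃ Fin i ⊕ (E \ T n i : Finset ℕ) :=
    (Fintype.equivFinOfCardEq hcard).symm
  let w : Fin i ⊕ (E \ T n i : Finset ℕ) → Fin n → ℝ :=
    Sum.elim (fun t => Pi.single ⟨t, by omega⟩ 1 - Pi.single ⟨n - 1 - t, by omega⟩ 1)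
      (fun _ _ => 1)
  let c : Fin i ⊕ (E \ T n i : Finset ℕ) → ℝ := Sum.elim (fun _ => 0) (fun j => (j : ℕ))
  have hl : ∀ (t : Fin i) x, onHyp (w (.inl t)) (c (.inl t)) x ↔
      x ⟨t, by omega⟩ = x ⟨n - 1 - t, by omega⟩ := by
    intro t x
    simp [onHyp, w, c, sub_mul, Finset.sum_sub_distrib, Pi.single_apply, sub_eq_zero]
  have hr : ∀ j x, onHyp (w (.inr j)) (c (.inr j)) x ↔ wt x = j := by
    intro j x
    simp only [onHyp, w, c, Sum.elim_inr, one_mul, wt]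
    norm_cast
  refine ⟨w ∘ e, c ∘ e, ?_, ?_, ?_⟩
  · intro z h0
    rcases h : e z with t | j
    · have h1 := congrFun h0 ⟨t, by omega⟩
      have h2 : (⟨t, by omega⟩ : Fin n) ≠ ⟨n - 1 - t, by omega⟩ := by
        simp only [ne_eq, Fin.mk.injEq]
        omega
      simp [h, w, h2] at h1
    · have h1 := congrFun h0 ⟨0, hn⟩
      simp [h, w] at h1
  · rintro x ⟨hx, hxE⟩
    by_cases hxT : wt x ∈ T n i
    · obtain ⟨t, ht⟩ := exists_eq_rev_of_wt_mem_T hi hx hxT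
      refine ⟨e.symm (.inl t), ?_⟩
      simpa using (hl t x).mpr ht
    · refine ⟨e.symm (.inr ⟨wt x, Finset.mem_sdiff.mpr ⟨hxE, hxT⟩⟩), ?_⟩
      simpa using (hr ⟨wt x, Finset.mem_sdiff.mpr ⟨hxE, hxT⟩⟩ x).mpr rfl
  · intro j hj hjE hsub
    rw [Ntot_two] at hj
    have hjT : j ∉ T n i := fun h => hjE (hT h)
    simp only [T, Finset.mem_union, Finset.mem_range, Finset.mem_Icc] at hjT
    let x : Fin n → ℕ := fun p => if (p : ℕ) < j then 1 else 0
    have hx : wt x = j := by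
      simp only [wt, x]
      rw [Fin.sum_univ_eq_sum_range (fun p => if p < j then 1 else 0) n, ← Finset.card_filter]
      have : (Finset.range n).filter (· < j) = Finset.range j := by
        ext p
        simp only [Finset.mem_filter, Finset.mem_range]
        omega
      rw [this, Finset.card_range]
    have hxg : x ∈ gridSet n (fun _ => 2) := by
      intro p
      simp only [x]
      split_ifs <;> simp
    obtain ⟨z, hz⟩ := hsub ⟨hxg, hx⟩
    simp only [Function.comp_apply] at hz
    rcases h : e z with t | j'
    · rw [h, hl] at hz
      simp only [x] at hz
      rw [if_pos (by omega), if_neg (by omega)] at hz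
      exact one_ne_zero hz
    · rw [h, hr, hx] at hz
      exact hjE (hz ▸ (Finset.mem_sdiff.mp j'.2).1)

/-- For `E ⊊ [0,n]`, the largest `i` with `T_{n,i} ⊆ E` is such that `E` misses `i` or `n - i`. -/
lemma notMem_or_sub_notMem {n i : ℕ} {E : Finset ℕ} (hE : E ⊂ Finset.range (n + 1))
    (hT : T n i ⊆ E) (hi : i ≤ n / 2) (hmax : ∀ i' ≤ n / 2, T n i' ⊆ E → i' ≤ i) :
    i ∉ E ∨ n - i ∉ E := by
  by_contra! h
  have hT' : T n (i + 1) ⊆ E := by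
    intro j hj
    by_cases hjT : j ∈ T n i
    · exact hT hjT
    · simp only [T, Finset.mem_union, Finset.mem_range, Finset.mem_Icc] at hj hjT
      obtain rfl | rfl : j = i ∨ j = n - i := by omega
      exacts [h.1, h.2]
  by_cases hi' : i + 1 ≤ n / 2
  · have := hmax _ hi' hT'
    omega
  · refine hE.2 fun j hj => hT' ?_
    simp only [T, Finset.mem_union, Finset.mem_range, Finset.mem_Icc] at hj ⊢
    omega

/-- `PHC_n(E) = PPC_n(E) = |E| - max{i ∈ [0,⌊n/2⌋] : T_{n,i} ⊆ E}`. -/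
theorem stmt4 (n : ℕ) (hn : 1 ≤ n) (E : Finset ℕ) (hE : E ⊂ Finset.range (n + 1)) :
    PHC n (fun _ => 2) E = PPC n (fun _ => 2) E ∧
    PPC n (fun _ => 2) E = E.card - sSup {i | i ≤ n / 2 ∧ T n i ⊆ E} := by
  set S := {i | i ≤ n / 2 ∧ T n i ⊆ E} with hS
  have hbdd : BddAbove S := ⟨n / 2, fun i hi => hi.1⟩
  have hne : S.Nonempty := ⟨0, Nat.zero_le _, by simp [T]⟩
  obtain ⟨hi, hT⟩ : sSup S ∈ S := Nat.sSup_mem hne hbdd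
  have hmiss := notMem_or_sub_notMem hE hT hi fun i' h1 h2 => le_csSup hbdd ⟨h1, h2⟩
  have hhyp := exists_hyperplanes hn (by omega) E hT
  have hPHC : PHC n (fun _ => 2) E ≤ E.card - sSup S := Nat.sInf_le hhyp
  obtain ⟨w, c, -, hcov, hprop⟩ := Nat.sInf_mem (⟨_, hhyp⟩ : Set.Nonempty {m |
    ∃ (w : Fin m → Fin n → ℝ) (c : Fin m → ℝ), (∀ t, w t ≠ 0) ∧
      (∀ x ∈ wdSet n (fun _ => 2) E, ∃ t, onHyp (w t) (c t) x) ∧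
      ∀ j ≤ Ntot n (fun _ => 2), j ∉ E →
        ¬ (layer n (fun _ => 2) j ⊆ {x | ∃ t, onHyp (w t) (c t) x})})
  obtain ⟨P, hPdeg, hPcov, hPprop⟩ := exists_polynomial_of_hyperplanes _ E w c hcov hprop
  have hPPC : PPC n (fun _ => 2) E ≤ PHC n (fun _ => 2) E := by
    refine le_trans ?_ hPdeg
    exact Nat.sInf_le ⟨P, rfl, hPcov, hPprop⟩
  have hlow : E.card - sSup S ≤ PPC n (fun _ => 2) E := by
    rw [PPC]
    refine le_csInf ⟨_, P, rfl, hPcov, hPprop⟩ ?_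
    rintro _ ⟨Q, rfl, hQ, hQprop⟩
    exact card_sub_le_totalDegree (by omega) Q E hE.1 hmiss hQ hQprop
  omega

end CoveringSymmetric
end
end
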